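/- arXiv:math/0305404 — 2 statements merged into one kernel-verified Lean document; each statement's English description precedes it below -/
import Mathlib

section
/- For coprime positive integers a and b, s(a,b) + s(b,a) = -1/4 + (1/12)(a/b + 1/(ab) + b/a), where s(a,b) = (1/(4b)) ∑_{k=1}^{b-1} cot(πka/b) cot(πk/b). -/
open Real Finset

noncomputable def dedekindSum (a b : ℕ) : ℝ :=
  (1 / (4 * (b : ℝ))) * ∑ k ∈ Finset.Icc 1 (b - 1),
    Real.cot (π * k * a / b) * Real.cot (π * k / b)

open Filter Topology

theorem sin_ne_zero_of_sin_nat_mul_ne_zero {n : ℕ} {θ : ℝ} (h : sin (n * θ) ≠ 0) :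
    sin θ ≠ 0 := by
  intro h0
  obtain ⟨m, rfl⟩ := sin_eq_zero_iff.1 h0
  exact h (by simpa [mul_assoc] using sin_int_mul_pi (n * m))

/-- If `α + β + γ = 0` then `cot α cot β + cot β cot γ + cot γ cot α = 1`. -/
theorem cot_mul_cot_sub_cot_add {α β : ℝ} (hα : sin α ≠ 0) (hβ : sin β ≠ 0)
    (hαβ : sin (α + β) ≠ 0) :
    cot α * cot β - cot β * cot (α + β) - cot α * cot (α + β) = 1 := by
  simp only [cot_eq_cos_div_sin]
  field_simp
  rw [sin_add, cos_add]
  ring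

theorem Complex.cot_eq_I_mul_one_sub {z : ℂ} (h : Complex.exp (2 * I * z) ≠ 1) :
    Complex.cot z = -I * (1 + 2 * (Complex.exp (2 * I * z) / (1 - Complex.exp (2 * I * z)))) := by
  have h1 : 1 - Complex.exp (2 * I * z) ≠ 0 := sub_ne_zero.2 h.symm
  rw [Complex.cot_eq_exp_ratio]
  field_simp
  linear_combination (1 + Complex.exp (2 * I * z)) * Complex.I_sq

theorem Complex.exp_two_I_mul_ne_one {x : ℝ} (h : Real.sin x ≠ 0) :
    Complex.exp (2 * I * x) ≠ 1 := by
  intro h1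
  obtain ⟨n, hn⟩ := Complex.exp_eq_one_iff.1 h1
  apply h
  have : (x : ℂ) = ((n * π : ℝ) : ℂ) := by
    push_cast
    have h2 : (2 * I : ℂ) ≠ 0 := by simp
    apply mul_left_cancel₀ h2
    rw [hn]; ring
  rw [Complex.ofReal_inj.1 this, Real.sin_int_mul_pi]

theorem IsPrimitiveRoot.sum_div_one_sub {K : Type*} [Field K] {n : ℕ} (hn : 0 < n) {ζ : K}
    (hζ : IsPrimitiveRoot ζ n) {w : K} (hw : w ^ n ≠ 1) :
    ∑ j ∈ range n, w * ζ ^ j / (1 - w * ζ ^ j) = n * (w ^ n / (1 - w ^ n)) := by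
  have hw' : 1 - w ^ n ≠ 0 := sub_ne_zero.2 hw.symm
  have hpow (j : ℕ) : (w * ζ ^ j) ^ n = w ^ n := by
    rw [mul_pow, ← pow_mul, mul_comm j, pow_mul, hζ.pow_eq_one, one_pow, mul_one]
  have hterm (j : ℕ) : w * ζ ^ j / (1 - w * ζ ^ j) =
      (∑ m ∈ range n, w ^ (m + 1) * (ζ ^ (m + 1)) ^ j) / (1 - w ^ n) := by
    have hj : 1 - w * ζ ^ j ≠ 0 := fun h ↦ hw (by rw [← hpow j, ← sub_eq_zero.1 h, one_pow])
    rw [div_eq_div_iff hj hw', ← hpow j, ← mul_neg_geom_sum, sum_mul, mul_sum, mul_sum]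
    refine sum_congr rfl fun m _ ↦ ?_
    ring
  have hζsum (m : ℕ) (hm : m ∈ range n) :
      ∑ j ∈ range n, (ζ ^ (m + 1)) ^ j = if m = n - 1 then (n : K) else 0 := by
    have hm := mem_range.1 hm
    split_ifs with h
    · have : m + 1 = n := by omega
      simp [this, hζ.pow_eq_one]
    · have h1 : ζ ^ (m + 1) ≠ 1 := hζ.pow_ne_one_of_pos_of_lt (by omega) (by omega)
      rw [geom_sum_eq h1, ← pow_mul, mul_comm, pow_mul, hζ.pow_eq_one, one_pow, sub_self, zero_div]
  simp_rw [hterm, ← sum_div]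
  rw [sum_comm]
  simp_rw [← mul_sum]
  rw [sum_congr rfl fun m hm ↦ by rw [hζsum m hm]]
  rw [sum_eq_single_of_mem (n - 1) (by simp; omega) (by intro m _ h; simp [h])]
  rw [if_pos rfl, Nat.sub_add_cancel hn]
  ring

theorem sum_cot_add_pi_mul_div {n : ℕ} (hn : 0 < n) {x : ℝ} (hx : sin (n * x) ≠ 0) :
    ∑ j ∈ range n, cot (x + π * j / n) = n * cot (n * x) := by
  have hn' : (n : ℝ) ≠ 0 := by positivity
  have hnC : (n : ℂ) ≠ 0 := by exact_mod_cast hn.ne'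
  have hsin (j : ℕ) : sin (x + π * j / n) ≠ 0 := by
    apply sin_ne_zero_of_sin_nat_mul_ne_zero (n := n)
    rw [show (n : ℝ) * (x + π * j / n) = n * x + j * π by field_simp, sin_add_nat_mul_pi]
    simp [hx]
  have hζ := Complex.isPrimitiveRoot_exp n hn.ne'
  have hexp (j : ℕ) : Complex.exp (2 * Complex.I * (x + π * j / n : ℝ)) =
      Complex.exp (2 * Complex.I * x) * Complex.exp (2 * π * Complex.I / n) ^ j := by
    rw [← Complex.exp_nat_mul, ← Complex.exp_add]
    congr 1
    push_cast
    field_simp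
  have hexpn : Complex.exp (2 * Complex.I * (n * x : ℝ)) = Complex.exp (2 * Complex.I * x) ^ n := by
    rw [← Complex.exp_nat_mul]
    congr 1
    push_cast
    ring
  have hne := Complex.exp_two_I_mul_ne_one hx
  apply Complex.ofReal_injective
  rw [Complex.ofReal_sum, Complex.ofReal_mul, Complex.ofReal_natCast, Complex.ofReal_cot,
    Complex.cot_eq_I_mul_one_sub hne]
  rw [sum_congr rfl fun j _ ↦ by
    rw [Complex.ofReal_cot, Complex.cot_eq_I_mul_one_sub (Complex.exp_two_I_mul_ne_one (hsin j)),
      hexp j]]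
  rw [hexpn] at hne ⊢
  rw [← mul_sum, sum_add_distrib, ← mul_sum, hζ.sum_div_one_sub hn hne]
  simp
  ring

/-- Summing the three-term cotangent relation over `α = x + πj/a`, `β = x + πk/b`. -/
theorem cot_reciprocity {a b : ℕ} (ha : 0 < a) (hb : 0 < b) {x : ℝ}
    (hx : sin ((2 * a * b : ℕ) * x) ≠ 0) :
    (a * b : ℝ) * (cot (a * x) * cot (b * x))
      - a * ∑ k ∈ range b, cot (2 * a * x + π * k * a / b) * cot (x + π * k / b)
      - b * ∑ j ∈ range a, cot (2 * b * x + π * j * b / a) * cot (x + π * j / a) = a * b := by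
  have ha' : (a : ℝ) ≠ 0 := by positivity
  have hb' : (b : ℝ) ≠ 0 := by positivity
  have hax : sin (a * x) ≠ 0 := by
    apply sin_ne_zero_of_sin_nat_mul_ne_zero (n := 2 * b)
    convert hx using 2; push_cast; ring
  have hbx : sin (b * x) ≠ 0 := by
    apply sin_ne_zero_of_sin_nat_mul_ne_zero (n := 2 * a)
    convert hx using 2; push_cast; ring
  have hα (j : ℕ) : sin (x + π * j / a) ≠ 0 := by
    apply sin_ne_zero_of_sin_nat_mul_ne_zero (n := a)
    rw [show (a : ℝ) * (x + π * j / a) = a * x + j * π by field_simp, sin_add_nat_mul_pi]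
    simp [hax]
  have hβ (k : ℕ) : sin (x + π * k / b) ≠ 0 := by
    apply sin_ne_zero_of_sin_nat_mul_ne_zero (n := b)
    rw [show (b : ℝ) * (x + π * k / b) = b * x + k * π by field_simp, sin_add_nat_mul_pi]
    simp [hbx]
  have hA (k : ℕ) : sin (a * (2 * x + π * k / b)) ≠ 0 := by
    apply sin_ne_zero_of_sin_nat_mul_ne_zero (n := b)
    rw [show (b : ℝ) * (a * (2 * x + π * k / b)) = (2 * a * b : ℕ) * x + (a * k : ℕ) * π by
      push_cast; field_simp, sin_add_nat_mul_pi]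
    exact mul_ne_zero (by simp) hx
  have hB (j : ℕ) : sin (b * (2 * x + π * j / a)) ≠ 0 := by
    apply sin_ne_zero_of_sin_nat_mul_ne_zero (n := a)
    rw [show (a : ℝ) * (b * (2 * x + π * j / a)) = (2 * a * b : ℕ) * x + (b * j : ℕ) * π by
      push_cast; field_simp, sin_add_nat_mul_pi]
    exact mul_ne_zero (by simp) hx
  have hαβ (j k : ℕ) : sin ((x + π * j / a) + (x + π * k / b)) ≠ 0 := by
    apply sin_ne_zero_of_sin_nat_mul_ne_zero (n := a)
    rw [show (a : ℝ) * ((x + π * j / a) + (x + π * k / b)) =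
      a * (2 * x + π * k / b) + j * π by field_simp; ring, sin_add_nat_mul_pi]
    exact mul_ne_zero (by simp) (hA k)
  have h1 : ∑ j ∈ range a, ∑ k ∈ range b, cot (x + π * j / a) * cot (x + π * k / b) =
      (a * b : ℝ) * (cot (a * x) * cot (b * x)) := by
    rw [← sum_mul_sum, sum_cot_add_pi_mul_div ha hax, sum_cot_add_pi_mul_div hb hbx]
    ring
  have h2 : ∑ j ∈ range a, ∑ k ∈ range b,
      cot (x + π * k / b) * cot ((x + π * j / a) + (x + π * k / b)) =
      a * ∑ k ∈ range b, cot (2 * a * x + π * k * a / b) * cot (x + π * k / b) := by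
    rw [sum_comm, mul_sum]
    refine sum_congr rfl fun k _ ↦ ?_
    rw [← mul_sum, show 2 * a * x + π * k * a / b = a * (2 * x + π * k / b) by ring, ← mul_assoc,
      ← sum_cot_add_pi_mul_div ha (hA k), mul_comm]
    congr 1
    exact sum_congr rfl fun j _ ↦ by congr 1; ring
  have h3 : ∑ j ∈ range a, ∑ k ∈ range b,
      cot (x + π * j / a) * cot ((x + π * j / a) + (x + π * k / b)) =
      b * ∑ j ∈ range a, cot (2 * b * x + π * j * b / a) * cot (x + π * j / a) := by
    rw [mul_sum]
    refine sum_congr rfl fun j _ ↦ ?_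
    rw [← mul_sum, show 2 * b * x + π * j * b / a = b * (2 * x + π * j / a) by ring, ← mul_assoc,
      ← sum_cot_add_pi_mul_div hb (hB j), mul_comm]
    congr 1
    exact sum_congr rfl fun k _ ↦ by congr 1; ring
  rw [← h1, ← h2, ← h3, ← sum_sub_distrib, ← sum_sub_distrib]
  simp_rw [← sum_sub_distrib]
  simp [cot_mul_cot_sub_cot_add (hα _) (hβ _) (hαβ _ _)]

theorem tendsto_cot_sub_inv_div :
    Tendsto (fun u : ℝ ↦ (cot u - u⁻¹) / u) (𝓝[≠] 0) (𝓝 (-1 / 3)) := by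
  have hsinc : Tendsto (fun u : ℝ ↦ sin u / u) (𝓝[≠] 0) (𝓝 1) := by
    have := (hasDerivAt_sin 0).tendsto_slope
    simpa [slope_fun_def, div_eq_inv_mul] using this
  have hnum : Tendsto (fun u : ℝ ↦ (u * cos u - sin u) / u ^ 3) (𝓝[≠] 0) (𝓝 (-1 / 3)) := by
    rw [tendsto_iff_norm_sub_tendsto_zero]
    have hlim : Tendsto (fun u : ℝ ↦ |u|) (𝓝[≠] 0) (𝓝 0) := by
      simpa using (continuous_abs.tendsto (0 : ℝ)).mono_left nhdsWithin_le_nhds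
    refine squeeze_zero' (.of_forall fun _ ↦ norm_nonneg _) ?_ hlim
    have hball : ∀ᶠ u : ℝ in 𝓝[≠] 0, |u| < 1 := hlim.eventually_lt_const one_pos
    filter_upwards [self_mem_nhdsWithin, hball] with u hu hu1
    have hu0 : u ≠ 0 := hu
    have hs := Real.sin_bound hu1.le
    have hc := Real.cos_bound hu1.le
    have hpos : 0 < |u| := abs_pos.2 hu0
    rw [show (u * cos u - sin u) / u ^ 3 - -1 / 3 =
      (u * (cos u - (1 - u ^ 2 / 2)) - (sin u - (u - u ^ 3 / 6))) / u ^ 3 by field_simp; ring,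
      norm_eq_abs, abs_div, div_le_iff₀ (by positivity), abs_pow]
    calc _ ≤ |u * (cos u - (1 - u ^ 2 / 2))| + |sin u - (u - u ^ 3 / 6)| := abs_sub _ _
      _ ≤ 1 * (|u| ^ 4 * (5 / 96)) + |u| ^ 4 * (5 / 96) := by
        rw [abs_mul]
        gcongr
        nlinarith [pow_pos hpos 4, pow_succ |u| 4]
      _ ≤ |u| * |u| ^ 3 := by nlinarith [pow_pos hpos 4]
  have h := hnum.div hsinc one_ne_zero
  rw [div_one] at h
  refine h.congr' ?_
  filter_upwards [self_mem_nhdsWithin, hsinc.eventually_ne one_ne_zero] with u hu hs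
  have hu0 : u ≠ 0 := hu
  have hs0 : sin u ≠ 0 := fun h0 ↦ hs (by simp [h0])
  rw [Pi.div_apply, cot_eq_cos_div_sin]
  field_simp

theorem tendsto_cot_mul_cot_sub {p q : ℝ} (hp : p ≠ 0) (hq : q ≠ 0) :
    Tendsto (fun x : ℝ ↦ cot (p * x) * cot (q * x) - 1 / (p * q * x ^ 2)) (𝓝[≠] 0)
      (𝓝 (-(p / q + q / p) / 3)) := by
  have hscale {r : ℝ} (hr : r ≠ 0) : Tendsto (fun x : ℝ ↦ r * x) (𝓝[≠] 0) (𝓝[≠] 0) := by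
    refine tendsto_nhdsWithin_iff.2 ⟨?_, ?_⟩
    · exact (Continuous.tendsto' (by fun_prop) _ _ (by simp)).mono_left nhdsWithin_le_nhds
    · filter_upwards [self_mem_nhdsWithin] with x hx using mul_ne_zero hr hx
  have hP := tendsto_cot_sub_inv_div.comp (hscale hp)
  have hQ := tendsto_cot_sub_inv_div.comp (hscale hq)
  have hX : Tendsto (fun x : ℝ ↦ p * q * x ^ 2) (𝓝[≠] 0) (𝓝 0) :=
    (Continuous.tendsto' (by fun_prop) _ _ (by simp)).mono_left nhdsWithin_le_nhds
  have h := ((hP.const_mul (p / q)).add (hQ.const_mul (q / p))).add (hX.mul (hP.mul hQ))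
  convert h.congr' ?_ using 2
  · ring
  filter_upwards [self_mem_nhdsWithin] with x hx
  have hx0 : x ≠ 0 := hx
  simp only [Function.comp_apply]
  field_simp
  ring

theorem sum_range_eq_add_sum_Icc {M : Type*} [AddCommMonoid M] {n : ℕ} (hn : 0 < n) (f : ℕ → M) :
    ∑ k ∈ range n, f k = f 0 + ∑ k ∈ Icc 1 (n - 1), f k := by
  rw [range_eq_Ico, sum_eq_sum_Ico_succ_bot hn]
  congr 2

theorem sin_pi_mul_div_ne_zero {n m : ℕ} (hn : 0 < n) (h : ¬ n ∣ m) : sin (π * m / n) ≠ 0 := by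
  intro h0
  obtain ⟨t, ht⟩ := sin_eq_zero_iff.1 h0
  have hn' : (n : ℝ) ≠ 0 := by positivity
  have hm : (m : ℝ) = n * t := by
    field_simp at ht
    linarith
  exact h (Int.natCast_dvd_natCast.1 ⟨t, by exact_mod_cast hm⟩)

theorem continuousAt_cot {x : ℝ} (h : sin x ≠ 0) : ContinuousAt cot x := by
  have : cot = fun y ↦ cos y / sin y := funext cot_eq_cos_div_sin
  rw [this]
  exact continuous_cos.continuousAt.div continuous_sin.continuousAt h

theorem tendsto_sum_cot_mul_cot {a b : ℕ} (hb : 0 < b) (hab : Nat.Coprime a b) :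
    Tendsto (fun x : ℝ ↦ ∑ k ∈ Icc 1 (b - 1),
        cot (2 * a * x + π * k * a / b) * cot (x + π * k / b)) (𝓝[≠] 0)
      (𝓝 (4 * b * dedekindSum a b)) := by
  have hb' : (b : ℝ) ≠ 0 := by positivity
  have hval : 4 * b * dedekindSum a b =
      ∑ k ∈ Icc 1 (b - 1), cot (π * k * a / b) * cot (π * k / b) := by
    rw [dedekindSum, ← mul_assoc, mul_one_div_cancel (by positivity), one_mul]
  rw [hval]
  refine tendsto_finsetSum _ fun k hk ↦ ?_
  have hk := mem_Icc.1 hk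
  have hbk : ¬ b ∣ k := fun h ↦ by have := Nat.le_of_dvd (by omega) h; omega
  have hbka : ¬ b ∣ k * a := fun h ↦ hbk (hab.symm.dvd_of_dvd_mul_right h)
  have h1 : sin (π * k * a / b) ≠ 0 := by
    simpa [mul_assoc] using sin_pi_mul_div_ne_zero hb hbka
  have h2 := sin_pi_mul_div_ne_zero hb hbk
  refine .mono_left (.mul ?_ ?_) nhdsWithin_le_nhds
  · exact (continuousAt_cot h1).tendsto.comp (Continuous.tendsto' (by fun_prop) _ _ (by simp))
  · exact (continuousAt_cot h2).tendsto.comp (Continuous.tendsto' (by fun_prop) _ _ (by simp))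

theorem dedekind_reciprocity (a b : ℕ) (ha : 0 < a) (hb : 0 < b)
    (hab : Nat.Coprime a b) :
    dedekindSum a b + dedekindSum b a =
      -1 / 4 + (1 / 12) * ((a : ℝ) / b + 1 / (a * b) + (b : ℝ) / a) := by
  have ha' : (a : ℝ) ≠ 0 := by positivity
  have hb' : (b : ℝ) ≠ 0 := by positivity
  have hlim := ((((tendsto_cot_mul_cot_sub ha' hb').const_mul (a * b : ℝ)).sub
    ((tendsto_cot_mul_cot_sub (mul_ne_zero two_ne_zero ha') one_ne_zero).const_mul (a : ℝ))).sub
    ((tendsto_cot_mul_cot_sub (mul_ne_zero two_ne_zero hb') one_ne_zero).const_mul (b : ℝ))).sub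
    (((tendsto_sum_cot_mul_cot hb hab).const_mul (a : ℝ)).add
      ((tendsto_sum_cot_mul_cot ha hab.symm).const_mul (b : ℝ)))
  have hsin : ∀ᶠ x : ℝ in 𝓝[≠] 0, sin ((2 * a * b : ℕ) * x) ≠ 0 := by
    have hc : ((2 * a * b : ℕ) : ℝ) ≠ 0 := by positivity
    have hd : HasDerivAt (fun x : ℝ ↦ sin ((2 * a * b : ℕ) * x)) ((2 * a * b : ℕ) : ℝ) 0 := by
      simpa using ((hasDerivAt_id (0 : ℝ)).const_mul ((2 * a * b : ℕ) : ℝ)).sin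
    simpa using hd.eventually_ne (c := 0) hc
  have heq := tendsto_nhds_unique (hlim.congr' (f₂ := fun _ ↦ (a * b : ℝ)) ?_) tendsto_const_nhds
  · field_simp at heq ⊢
    linarith
  filter_upwards [hsin, self_mem_nhdsWithin] with x hx hx0
  have hx0 : x ≠ 0 := hx0
  have h := cot_reciprocity ha hb hx
  rw [sum_range_eq_add_sum_Icc hb, sum_range_eq_add_sum_Icc ha] at h
  simp only [Nat.cast_zero, mul_zero, zero_mul, zero_div, add_zero] at h
  have hpole : (a * b : ℝ) * (1 / (a * b * x ^ 2)) - a * (1 / (2 * a * 1 * x ^ 2)) -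
      b * (1 / (2 * b * 1 * x ^ 2)) = 0 := by
    field_simp
    ring
  rw [one_mul]
  linear_combination h - hpole
end

section
/- Pick's theorem: for a convex lattice polygon P in ℝ² with area A, I interior lattice points and B boundary lattice points, A = I + B/2 - 1. -/
open MeasureTheory

/-- `g` is, on `[a, b]`, the least concave majorant of the finite set `V` of lattice points. -/
structure IsUpperEnvelope (V : Finset (ℤ × ℤ)) (a b : ℤ) (g : ℝ → ℝ) : Prop where
  concaveOn : ConcaveOn ℝ (Set.Icc (a : ℝ) b) g
  fst_mem : ∀ q ∈ V, q.1 ∈ Set.Icc a b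
  le : ∀ q ∈ V, (q.2 : ℝ) ≤ g q.1
  le_affine : ∀ m c : ℝ, (∀ q ∈ V, (q.2 : ℝ) ≤ m * q.1 + c) →
    ∀ x ∈ Set.Icc (a : ℝ) b, g x ≤ m * x + c

namespace IsUpperEnvelope

variable {V : Finset (ℤ × ℤ)} {a b : ℤ} {g : ℝ → ℝ}

theorem eq_intCast_of_isMax (h : IsUpperEnvelope V a b g) {m : ℝ} {q : ℤ × ℤ} (hq : q ∈ V)
    (hmax : ∀ q' ∈ V, (q'.2 : ℝ) - m * q'.1 ≤ q.2 - m * q.1) : g q.1 = q.2 := by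
  obtain ⟨h1, h2⟩ := h.fst_mem q hq
  have := h.le_affine m (q.2 - m * q.1) (fun q' hq' => by linarith [hmax q' hq']) q.1
    ⟨by exact_mod_cast h1, by exact_mod_cast h2⟩
  linarith [h.le q hq]

theorem exists_intCast_left (h : IsUpperEnvelope V a b g) (ha : ∃ q ∈ V, q.1 = a) :
    ∃ n : ℤ, g a = n := by
  obtain ⟨q₀, hq₀, rfl⟩ := ha
  obtain ⟨q, hq, hmax⟩ := (V.filter (fun q => q.1 = q₀.1)).exists_max_image (fun q => q.2)
    ⟨q₀, by simp [hq₀]⟩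
  obtain ⟨r, hr, hrmax⟩ := V.exists_max_image (fun q => q.2) ⟨q₀, hq₀⟩
  simp only [Finset.mem_filter] at hq hmax
  refine ⟨q.2, ?_⟩
  rw [← hq.2]
  refine h.eq_intCast_of_isMax (m := |((r.2 : ℝ) - q.2)|) hq.1 fun q' hq' => ?_
  rcases eq_or_lt_of_le (h.fst_mem q' hq').1 with h1 | h1
  · have : (q'.2 : ℝ) ≤ q.2 := by exact_mod_cast hmax q' ⟨hq', h1.symm⟩
    rw [hq.2, h1]; linarith
  · have h2 : (q'.2 : ℝ) ≤ r.2 := by exact_mod_cast hrmax q' hq'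
    have h3 : (q.1 : ℝ) + 1 ≤ q'.1 := by rw [hq.2]; exact_mod_cast h1
    nlinarith [le_abs_self ((r.2 : ℝ) - q.2), abs_nonneg ((r.2 : ℝ) - q.2)]

theorem exists_intCast_right (h : IsUpperEnvelope V a b g) (hb : ∃ q ∈ V, q.1 = b) :
    ∃ n : ℤ, g b = n := by
  obtain ⟨q₀, hq₀, rfl⟩ := hb
  obtain ⟨q, hq, hmax⟩ := (V.filter (fun q => q.1 = q₀.1)).exists_max_image (fun q => q.2)
    ⟨q₀, by simp [hq₀]⟩
  obtain ⟨r, hr, hrmax⟩ := V.exists_max_image (fun q => q.2) ⟨q₀, hq₀⟩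
  simp only [Finset.mem_filter] at hq hmax
  refine ⟨q.2, ?_⟩
  rw [← hq.2]
  refine h.eq_intCast_of_isMax (m := -|((r.2 : ℝ) - q.2)|) hq.1 fun q' hq' => ?_
  rcases eq_or_lt_of_le (h.fst_mem q' hq').2 with h1 | h1
  · have : (q'.2 : ℝ) ≤ q.2 := by exact_mod_cast hmax q' ⟨hq', h1⟩
    rw [hq.2, h1]; linarith
  · have h2 : (q'.2 : ℝ) ≤ r.2 := by exact_mod_cast hrmax q' hq'
    have h3 : (q'.1 : ℝ) + 1 ≤ q.1 := by rw [hq.2]; exact_mod_cast h1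
    nlinarith [le_abs_self ((r.2 : ℝ) - q.2), abs_nonneg ((r.2 : ℝ) - q.2)]

end IsUpperEnvelope

/-- The trapezoidal rule with symmetrized rounding is exact for an affine function with integer
values at the integer endpoints `u < v`. -/
theorem two_mul_integral_of_affine {g : ℝ → ℝ} {u v n k : ℤ} {m : ℝ} (huv : u < v)
    (hg : ∀ x ∈ Set.Icc (u : ℝ) v, g x = n + m * (x - u)) (hk : (k : ℝ) = n + m * (v - u)) :
    2 * ∫ x in (u : ℝ)..v, g x =
      ∑ x ∈ Finset.Ico u v, ((⌊g x⌋ : ℝ) + ⌈g x⌉) + k - n := by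
  have huv' : (u : ℝ) < v := by exact_mod_cast huv
  have hint : ∫ x in (u : ℝ)..v, g x = (v - u) * (n + k) / 2 := by
    rw [intervalIntegral.integral_congr (g := fun x => n + m * (x - u))
      (by rw [Set.uIcc_of_le huv'.le]; exact hg)]
    rw [intervalIntegral.integral_add (by simp)
        (by apply Continuous.intervalIntegrable; fun_prop),
      intervalIntegral.integral_const_mul, intervalIntegral.integral_sub (by simp) (by simp)]
    simp only [intervalIntegral.integral_const, integral_id, smul_eq_mul]
    rw [hk]; ring
  have hgu : g u = n := by rw [hg u ⟨le_rfl, huv'.le⟩]; ring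
  have hsymm : ∑ x ∈ Finset.Ioo u v, ((⌊g x⌋ : ℝ) + ⌈g x⌉) =
      ∑ x ∈ Finset.Ioo u v, (2 * ((n : ℝ) + k) - ((⌊g x⌋ : ℝ) + ⌈g x⌉)) := by
    refine Finset.sum_nbij' (fun x => u + v - x) (fun x => u + v - x) ?_ ?_ ?_ ?_ ?_
    · intro x hx; simp only [Finset.mem_Ioo] at hx ⊢; omega
    · intro x hx; simp only [Finset.mem_Ioo] at hx ⊢; omega
    · intro x _; ring
    · intro x _; ring
    · intro x hx
      simp only [Finset.mem_Ioo] at hx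
      have h1 : (u : ℝ) < x := by exact_mod_cast hx.1
      have h2 : (x : ℝ) < v := by exact_mod_cast hx.2
      have h3 : g ((u + v - x : ℤ) : ℝ) = ((n + k : ℤ) : ℝ) + -g x := by
        rw [hg _ ⟨by push_cast; linarith, by push_cast; linarith⟩, hg x ⟨h1.le, h2.le⟩]
        push_cast; rw [hk]; ring
      rw [h3, Int.floor_intCast_add, Int.ceil_intCast_add, Int.floor_neg, Int.ceil_neg]
      push_cast; ring
  rw [Finset.sum_sub_distrib, Finset.sum_const, nsmul_eq_mul, Int.card_Ioo] at hsymm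
  have hc : (((v - u - 1).toNat : ℕ) : ℝ) = v - u - 1 := by
    have : (((v - u - 1).toNat : ℕ) : ℤ) = v - u - 1 := Int.toNat_of_nonneg (by omega)
    exact_mod_cast this
  rw [hc] at hsymm
  rw [← Finset.Ioo_insert_left huv, Finset.sum_insert (by simp), hgu, hint]
  simp only [Int.floor_intCast, Int.ceil_intCast]
  linarith

theorem IsUpperEnvelope.intervalIntegrable_and_two_mul_integral {V : Finset (ℤ × ℤ)} {a b : ℤ}
    {g : ℝ → ℝ} (h : IsUpperEnvelope V a b g) (hV : V.Nonempty) {u v n k : ℤ} (hau : a ≤ u)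
    (huv : u < v) (hvb : v ≤ b) (hu : g u = n) (hv : g v = k) :
    IntervalIntegrable g volume u v ∧ 2 * ∫ x in (u : ℝ)..v, g x =
      ∑ x ∈ Finset.Ico u v, ((⌊g x⌋ : ℝ) + ⌈g x⌉) + k - n := by
  induction hN : (v - u).toNat using Nat.strong_induction_on generalizing u v n k with
  | _ N ih =>
  have huv' : (u : ℝ) < v := by exact_mod_cast huv
  have huI : (u : ℝ) ∈ Set.Icc (a : ℝ) b :=
    ⟨by exact_mod_cast hau, by exact_mod_cast (huv.le.trans hvb)⟩
  have hvI : (v : ℝ) ∈ Set.Icc (a : ℝ) b :=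
    ⟨by exact_mod_cast (hau.trans huv.le), by exact_mod_cast hvb⟩
  have hd : (0 : ℝ) < v - u := sub_pos.2 huv'
  obtain ⟨m, hm⟩ : ∃ m : ℝ, m = ((k : ℝ) - n) / (v - u) := ⟨_, rfl⟩
  have hk : (k : ℝ) = n + m * (v - u) := by rw [hm]; field_simp; ring
  obtain ⟨q, hq, hmax⟩ := V.exists_max_image (fun q => (q.2 : ℝ) - m * q.1) hV
  obtain ⟨hqa, hqb⟩ := h.fst_mem q hq
  have hqI : (q.1 : ℝ) ∈ Set.Icc (a : ℝ) b := ⟨by exact_mod_cast hqa, by exact_mod_cast hqb⟩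
  have hgq := h.eq_intCast_of_isMax hq hmax
  rcases le_or_gt ((q.2 : ℝ) - m * q.1) (n - m * u) with hle | hlt
  · have haff : ∀ x ∈ Set.Icc (u : ℝ) v, g x = n + m * (x - u) := by
      intro x hx
      apply le_antisymm
      · have := h.le_affine m (n - m * u) (fun q' hq' => by linarith [hmax q' hq']) x
          ⟨huI.1.trans hx.1, hx.2.trans hvI.2⟩
        linarith
      · have hl : 0 ≤ ((v : ℝ) - x) / (v - u) := div_nonneg (by linarith [hx.2]) hd.le
        have hr : 0 ≤ (x - (u : ℝ)) / (v - u) := div_nonneg (by linarith [hx.1]) hd.le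
        have := h.concaveOn.2 huI hvI hl hr (by field_simp; ring)
        simp only [smul_eq_mul] at this
        rw [hu, hv, hk] at this
        have e1 : ((v : ℝ) - x) / (v - u) * u + (x - u) / (v - u) * v = x := by
          field_simp; ring
        have e2 : ((v : ℝ) - x) / (v - u) * n + (x - u) / (v - u) * (n + m * (v - u)) =
            n + m * (x - u) := by
          field_simp; ring
        rwa [e1, e2] at this
    refine ⟨?_, two_mul_integral_of_affine huv haff hk⟩
    refine IntervalIntegrable.congr (f := fun x => n + m * (x - u)) ?_
      (by apply Continuous.intervalIntegrable; fun_prop)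
    intro x hx
    rw [Set.uIoc_of_le huv'.le] at hx
    exact (haff x ⟨hx.1.le, hx.2⟩).symm
  · have huq : u < q.1 := by
      by_contra! hcon
      rcases eq_or_lt_of_le hcon with he | hl
      · rw [he, hu] at hgq
        rw [he] at hlt
        linarith
      · have hl' : (q.1 : ℝ) < u := by exact_mod_cast hl
        have := h.concaveOn.slope_anti_adjacent hqI hvI hl' huv'
        rw [hu, hv, hgq, ← hm, le_div_iff₀ (by linarith)] at this
        linarith
    have hqv : q.1 < v := by
      by_contra! hcon
      rcases eq_or_lt_of_le hcon with he | hl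
      · rw [← he, hv] at hgq
        rw [← he] at hlt
        linarith
      · have hl' : (v : ℝ) < q.1 := by exact_mod_cast hl
        have := h.concaveOn.slope_anti_adjacent huI hqI huv' hl'
        rw [hu, hv, hgq, ← hm, div_le_iff₀ (by linarith)] at this
        linarith
    obtain ⟨i1, e1⟩ := ih _ (by omega) hau huq (hqv.le.trans hvb) hu hgq rfl
    obtain ⟨i2, e2⟩ := ih _ (by omega) (hau.trans huq.le) hqv hvb hgq hv rfl
    refine ⟨i1.trans i2, ?_⟩
    rw [← intervalIntegral.integral_add_adjacent_intervals i1 i2, mul_add, e1, e2,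
      ← Finset.Ico_union_Ico_eq_Ico huq.le hqv.le,
      Finset.sum_union (Finset.Ico_disjoint_Ico_consecutive _ _ _)]
    ring

/-- The convex hull in the plane of a finite set of lattice points. -/
def latticeHull (V : Finset (ℤ × ℤ)) : Set (ℝ × ℝ) :=
  convexHull ℝ ((fun q : ℤ × ℤ => ((q.1 : ℝ), (q.2 : ℝ))) '' ↑V)

/-- The upper boundary function of the convex hull of a finite set of lattice points. -/
noncomputable def upperBoundary (V : Finset (ℤ × ℤ)) (x : ℝ) : ℝ :=
  sSup {y | (x, y) ∈ latticeHull V}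

section latticeHull

variable {V : Finset (ℤ × ℤ)} {a b : ℤ} {x y : ℝ}

theorem convex_latticeHull (V : Finset (ℤ × ℤ)) : Convex ℝ (latticeHull V) :=
  convex_convexHull ℝ _

theorem isCompact_latticeHull (V : Finset (ℤ × ℤ)) : IsCompact (latticeHull V) :=
  (V.finite_toSet.image _).isCompact_convexHull ℝ

theorem mem_latticeHull {q : ℤ × ℤ} (hq : q ∈ V) : ((q.1 : ℝ), (q.2 : ℝ)) ∈ latticeHull V :=
  subset_convexHull ℝ _ ⟨q, hq, rfl⟩

theorem latticeHull_affine_le {r s c : ℝ} (h : ∀ q ∈ V, r * q.1 + s * q.2 ≤ c)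
    (hxy : (x, y) ∈ latticeHull V) : r * x + s * y ≤ c := by
  have hconv : Convex ℝ {p : ℝ × ℝ | r * p.1 + s * p.2 ≤ c} := by
    refine convex_halfSpace_le (f := fun p : ℝ × ℝ => r * p.1 + s * p.2) ⟨?_, ?_⟩ c
    · intro p q; simp only [Prod.fst_add, Prod.snd_add]; ring
    · intro t p; simp only [Prod.smul_fst, Prod.smul_snd, smul_eq_mul]; ring
  refine convexHull_min ?_ hconv hxy
  rintro _ ⟨q, hq, rfl⟩
  exact h q hq

theorem fst_mem_Icc_of_mem_latticeHull (h : ∀ q ∈ V, q.1 ∈ Set.Icc a b)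
    (hxy : (x, y) ∈ latticeHull V) : x ∈ Set.Icc (a : ℝ) b := by
  constructor
  · have := latticeHull_affine_le (r := -1) (s := 0) (c := -a) (fun q hq => by
      have : (a : ℝ) ≤ q.1 := by exact_mod_cast (h q hq).1
      linarith) hxy
    linarith
  · have := latticeHull_affine_le (r := 1) (s := 0) (c := b) (fun q hq => by
      have : (q.1 : ℝ) ≤ b := by exact_mod_cast (h q hq).2
      linarith) hxy
    linarith

theorem bddAbove_column (V : Finset (ℤ × ℤ)) (x : ℝ) :
    BddAbove {y | (x, y) ∈ latticeHull V} := by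
  refine ((isCompact_latticeHull V).image continuous_snd).bddAbove.mono ?_
  intro y hy
  exact ⟨(x, y), hy, rfl⟩

theorem le_upperBoundary (hxy : (x, y) ∈ latticeHull V) : y ≤ upperBoundary V x :=
  le_csSup (bddAbove_column V x) hxy

theorem column_nonempty (ha : ∃ q ∈ V, q.1 = a) (hb : ∃ q ∈ V, q.1 = b)
    (hx : x ∈ Set.Icc (a : ℝ) b) : {y | (x, y) ∈ latticeHull V}.Nonempty := by
  obtain ⟨p, hp, rfl⟩ := ha
  obtain ⟨q, hq, rfl⟩ := hb
  have hconv : Convex ℝ (Prod.fst '' latticeHull V) :=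
    (convex_latticeHull V).linear_image (LinearMap.fst ℝ ℝ ℝ)
  obtain ⟨⟨x', y⟩, h, rfl⟩ := hconv.ordConnected.out ⟨_, mem_latticeHull hp, rfl⟩
    ⟨_, mem_latticeHull hq, rfl⟩ hx
  exact ⟨y, h⟩

theorem upperBoundary_mem (ha : ∃ q ∈ V, q.1 = a) (hb : ∃ q ∈ V, q.1 = b)
    (hx : x ∈ Set.Icc (a : ℝ) b) : (x, upperBoundary V x) ∈ latticeHull V := by
  have hcl : IsClosed {y | (x, y) ∈ latticeHull V} :=
    (isCompact_latticeHull V).isClosed.preimage (Continuous.prodMk_right x)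
  exact hcl.csSup_mem (column_nonempty ha hb hx) (bddAbove_column V x)

theorem isUpperEnvelope_upperBoundary (h : ∀ q ∈ V, q.1 ∈ Set.Icc a b) (ha : ∃ q ∈ V, q.1 = a)
    (hb : ∃ q ∈ V, q.1 = b) : IsUpperEnvelope V a b (upperBoundary V) where
  concaveOn := ⟨convex_Icc _ _, fun x hx x' hx' s t hs ht hst => le_upperBoundary <|
    convex_latticeHull V (upperBoundary_mem ha hb hx) (upperBoundary_mem ha hb hx') hs ht hst⟩
  fst_mem := h
  le q hq := le_upperBoundary (mem_latticeHull hq)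
  le_affine m c hc x hx := by
    have := latticeHull_affine_le (r := -m) (s := 1) (c := c)
      (fun q hq => by linarith [hc q hq]) (upperBoundary_mem ha hb hx)
    linarith

/-- Reflection of a set of lattice points in the horizontal axis. -/
def reflect (V : Finset (ℤ × ℤ)) : Finset (ℤ × ℤ) :=
  V.image fun q => (q.1, -q.2)

theorem mem_latticeHull_reflect : (x, y) ∈ latticeHull (reflect V) ↔ (x, -y) ∈ latticeHull V := by
  let L : ℝ × ℝ →ₗ[ℝ] ℝ × ℝ := LinearMap.prodMap LinearMap.id (-LinearMap.id)
  have hL : latticeHull (reflect V) = L '' latticeHull V := by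
    rw [latticeHull, latticeHull, LinearMap.image_convexHull, reflect, Finset.coe_image,
      Set.image_image, Set.image_image]
    simp [L]
  rw [hL]
  constructor
  · rintro ⟨⟨x', y'⟩, h, he⟩
    simp only [L, LinearMap.prodMap_apply, LinearMap.id_apply, LinearMap.neg_apply,
      Prod.mk.injEq] at he
    rw [← he.1, ← he.2, neg_neg]; exact h
  · intro h
    exact ⟨(x, -y), h, by simp [L]⟩

theorem exists_mem_reflect_fst (ha : ∃ q ∈ V, q.1 = a) : ∃ q ∈ reflect V, q.1 = a := by
  obtain ⟨q, hq, rfl⟩ := ha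
  exact ⟨(q.1, -q.2), Finset.mem_image_of_mem _ hq, rfl⟩

/-- A lattice polygon is the region between its lower and upper boundary functions. -/
theorem mem_latticeHull_iff (h : ∀ q ∈ V, q.1 ∈ Set.Icc a b) (ha : ∃ q ∈ V, q.1 = a)
    (hb : ∃ q ∈ V, q.1 = b) : (x, y) ∈ latticeHull V ↔
      x ∈ Set.Icc (a : ℝ) b ∧ -upperBoundary (reflect V) x ≤ y ∧ y ≤ upperBoundary V x := by
  constructor
  · intro hxy
    refine ⟨fst_mem_Icc_of_mem_latticeHull h hxy, ?_, le_upperBoundary hxy⟩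
    have : -y ≤ upperBoundary (reflect V) x :=
      le_upperBoundary (mem_latticeHull_reflect.2 (by rwa [neg_neg]))
    linarith
  · rintro ⟨hx, h1, h2⟩
    have hu := upperBoundary_mem ha hb hx
    have hl := mem_latticeHull_reflect.1
      (upperBoundary_mem (exists_mem_reflect_fst ha) (exists_mem_reflect_fst hb) hx)
    have hconv : Convex ℝ {y | (x, y) ∈ latticeHull V} := by
      intro s hs t ht c d hc hd hcd
      have := convex_latticeHull V hs ht hc hd hcd
      simpa [← add_mul, hcd] using this
    exact hconv.ordConnected.out hl hu ⟨h1, h2⟩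

end latticeHull

theorem interior_eq_regionBetween {P : Set (ℝ × ℝ)} {f g : ℝ → ℝ} {a b : ℝ}
    (hP : ∀ x y, (x, y) ∈ P ↔ x ∈ Set.Icc a b ∧ f x ≤ y ∧ y ≤ g x)
    (hf : ConvexOn ℝ (Set.Icc a b) f) (hg : ConcaveOn ℝ (Set.Icc a b) g) :
    interior P = regionBetween f g (Set.Ioo a b) := by
  apply Set.Subset.antisymm
  · rintro ⟨x, y⟩ hxy
    have hnhds := mem_interior_iff_mem_nhds.1 hxy
    obtain ⟨ε, hε, hball⟩ := Metric.mem_nhds_iff.1 hnhds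
    have key : ∀ s t : ℝ, |s| < ε → |t| < ε → (x + s, y + t) ∈ P := fun s t hs ht => hball (by
      rw [Metric.mem_ball, Prod.dist_eq, max_lt_iff]
      simp [hs, ht])
    have hp : |ε / 2| < ε := by rw [abs_of_pos (by linarith)]; linarith
    have hn : |-(ε / 2)| < ε := by rwa [abs_neg]
    have h0 : |(0 : ℝ)| < ε := by simpa
    have h1 := ((hP _ _).1 (key _ _ hp h0)).1.2
    have h2 := ((hP _ _).1 (key _ _ hn h0)).1.1
    have h3 := ((hP _ _).1 (key _ _ h0 hp)).2.2
    have h4 := ((hP _ _).1 (key _ _ h0 hn)).2.1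
    simp only [add_zero] at h3 h4
    simp only [regionBetween, Set.mem_ofPred_eq, Set.mem_Ioo]
    refine ⟨⟨?_, ?_⟩, ?_, ?_⟩ <;> linarith
  · apply interior_maximal
    · rintro ⟨x, y⟩ ⟨hx, hy⟩
      exact (hP _ _).2 ⟨⟨hx.1.le, hx.2.le⟩, hy.1.le, hy.2.le⟩
    · have hfc : ContinuousOn f (Set.Ioo a b) := by
        simpa using hf.continuousOn_interior
      have hgc : ContinuousOn g (Set.Ioo a b) := by
        simpa using hg.continuousOn_interior
      have hfst : Set.MapsTo Prod.fst (Prod.fst ⁻¹' Set.Ioo a b : Set (ℝ × ℝ)) (Set.Ioo a b) :=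
        fun _ h => h
      have hopen : IsOpen (Prod.fst ⁻¹' Set.Ioo a b : Set (ℝ × ℝ)) :=
        isOpen_Ioo.preimage continuous_fst
      have h1 := ContinuousOn.isOpen_inter_preimage (f := fun p : ℝ × ℝ => p.2 - f p.1)
        (continuousOn_snd.sub (hfc.comp continuousOn_fst hfst)) hopen (isOpen_Ioi (a := (0 : ℝ)))
      have h2 := ContinuousOn.isOpen_inter_preimage (f := fun p : ℝ × ℝ => g p.1 - p.2)
        ((hgc.comp continuousOn_fst hfst).sub continuousOn_snd) hopen (isOpen_Ioi (a := (0 : ℝ)))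
      convert h1.inter h2 using 1
      ext ⟨x, y⟩
      simp only [regionBetween, Set.mem_ofPred_eq, Set.mem_inter_iff, Set.mem_preimage,
        Set.mem_Ioi, sub_pos, Set.mem_Ioo]
      tauto

theorem ncard_setOf_fst_mem_snd_mem (s : Finset ℤ) (t : ℤ → Finset ℤ) :
    {p : ℤ × ℤ | p.1 ∈ s ∧ p.2 ∈ t p.1}.Finite ∧
      {p : ℤ × ℤ | p.1 ∈ s ∧ p.2 ∈ t p.1}.ncard = ∑ x ∈ s, (t x).card := by
  have h : {p : ℤ × ℤ | p.1 ∈ s ∧ p.2 ∈ t p.1} =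
      ↑((s.sigma t).map (Equiv.sigmaEquivProd ℤ ℤ).toEmbedding) := by
    ext ⟨x, y⟩
    simp
  rw [h]
  exact ⟨Finset.finite_toSet _, by rw [Set.ncard_coe_finset, Finset.card_map, Finset.card_sigma]⟩

theorem ConcaveOn.pos_of_mem_Ioo {d : ℝ → ℝ} {a b x x₀ : ℝ} (hd : ConcaveOn ℝ (Set.Icc a b) d)
    (hnonneg : ∀ z ∈ Set.Icc a b, 0 ≤ d z) (hx₀ : x₀ ∈ Set.Icc a b) (hpos : 0 < d x₀)
    (hx : x ∈ Set.Ioo a b) : 0 < d x := by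
  have hab : a ≤ b := hx₀.1.trans hx₀.2
  by_contra! hcon
  rcases lt_trichotomy x x₀ with hlt | rfl | hlt
  · have h := hd.slope_anti_adjacent ⟨le_rfl, hab⟩ hx₀ hx.1 hlt
    have h1 : 0 < (d x₀ - d x) / (x₀ - x) := div_pos (by linarith) (by linarith)
    have h2 : (d x - d a) / (x - a) ≤ 0 :=
      div_nonpos_of_nonpos_of_nonneg (by linarith [hnonneg a ⟨le_rfl, hab⟩]) (by linarith [hx.1])
    linarith
  · linarith
  · have h := hd.slope_anti_adjacent hx₀ ⟨hab, le_rfl⟩ hlt hx.2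
    have h1 : (d x - d x₀) / (x - x₀) < 0 := div_neg_of_neg_of_pos (by linarith) (by linarith)
    have h2 : 0 ≤ (d b - d x) / (b - x) :=
      div_nonneg (by linarith [hnonneg b ⟨hab, le_rfl⟩]) (by linarith [hx.2])
    linarith

/-- The number of lattice points of a polygon plus the number of its interior lattice points,
columnwise. The polygon lies above `-F` and below `g`, over `[a, b]`. -/
theorem ncard_add_ncard_interior {P : Set (ℝ × ℝ)} {F g : ℝ → ℝ} {a b : ℤ} (hab : a < b)
    (hP : ∀ x y, (x, y) ∈ P ↔ x ∈ Set.Icc (a : ℝ) b ∧ -F x ≤ y ∧ y ≤ g x)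
    (hPi : interior P = regionBetween (fun x => -F x) g (Set.Ioo (a : ℝ) b))
    (hle : ∀ x ∈ Set.Icc (a : ℝ) b, 0 ≤ g x + F x)
    (hlt : ∀ x ∈ Set.Ioo (a : ℝ) b, 0 < g x + F x)
    {na nb ka kb : ℤ} (hga : g a = na) (hgb : g b = nb) (hFa : F a = ka) (hFb : F b = kb) :
    {p : ℤ × ℤ | ((p.1 : ℝ), (p.2 : ℝ)) ∈ P}.Finite ∧
      (({p : ℤ × ℤ | ((p.1 : ℝ), (p.2 : ℝ)) ∈ P}.ncard : ℝ) +
        {p : ℤ × ℤ | ((p.1 : ℝ), (p.2 : ℝ)) ∈ interior P}.ncard =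
      (∑ x ∈ Finset.Ico a b, ((⌊g x⌋ : ℝ) + ⌈g x⌉) + nb - na) +
        (∑ x ∈ Finset.Ico a b, ((⌊F x⌋ : ℝ) + ⌈F x⌉) + kb - ka) + 2) := by
  have hN : {p : ℤ × ℤ | ((p.1 : ℝ), (p.2 : ℝ)) ∈ P} =
      {p : ℤ × ℤ | p.1 ∈ Finset.Icc a b ∧ p.2 ∈ Finset.Icc (-⌊F p.1⌋) ⌊g p.1⌋} := by
    ext ⟨x, y⟩
    simp only [Set.mem_ofPred_eq, hP, Finset.mem_Icc, Set.mem_Icc, Int.cast_le, Int.le_floor,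
      ← Int.ceil_neg, Int.ceil_le]
  have hI : {p : ℤ × ℤ | ((p.1 : ℝ), (p.2 : ℝ)) ∈ interior P} =
      {p : ℤ × ℤ | p.1 ∈ Finset.Ioo a b ∧ p.2 ∈ Finset.Ioo (-⌈F p.1⌉) ⌈g p.1⌉} := by
    ext ⟨x, y⟩
    simp only [Set.mem_ofPred_eq, hPi, regionBetween, Finset.mem_Ioo, Set.mem_Ioo, Int.cast_lt,
      Int.lt_ceil, ← Int.floor_neg, Int.floor_lt]
  obtain ⟨hfin, hcardN⟩ := ncard_setOf_fst_mem_snd_mem (Finset.Icc a b)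
    (fun x => Finset.Icc (-⌊F x⌋) ⌊g x⌋)
  have hcardI := (ncard_setOf_fst_mem_snd_mem (Finset.Ioo a b)
    (fun x => Finset.Ioo (-⌈F x⌉) ⌈g x⌉)).2
  rw [hN, hI]
  refine ⟨hfin, ?_⟩
  rw [hcardN, hcardI]
  have hcastI : ∀ x ∈ Finset.Ioo a b, (x : ℝ) ∈ Set.Ioo (a : ℝ) b := fun x hx => by
    rw [Finset.mem_Ioo] at hx
    exact ⟨by exact_mod_cast hx.1, by exact_mod_cast hx.2⟩
  have hcolN : ∀ x ∈ Finset.Ioo a b,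
      ((Finset.Icc (-⌊F x⌋) ⌊g x⌋).card : ℝ) = ⌊g x⌋ + ⌊F x⌋ + 1 := fun x hx => by
    have h0 : (-1 : ℤ) ≤ ⌊g x⌋ + ⌊F x⌋ := by
      have h1 := hlt x (hcastI x hx)
      have h2 : ((-2 : ℤ) : ℝ) < ((⌊g x⌋ + ⌊F x⌋ : ℤ) : ℝ) := by
        push_cast
        linarith [Int.lt_floor_add_one (g x), Int.lt_floor_add_one (F x)]
      have := Int.cast_lt.1 h2
      omega
    have : ((Finset.Icc (-⌊F x⌋) ⌊g x⌋).card : ℤ) = ⌊g x⌋ + ⌊F x⌋ + 1 := by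
      rw [Int.card_Icc]; omega
    exact_mod_cast this
  have hcolI : ∀ x ∈ Finset.Ioo a b,
      ((Finset.Ioo (-⌈F x⌉) ⌈g x⌉).card : ℝ) = ⌈g x⌉ + ⌈F x⌉ - 1 := fun x hx => by
    have h0 : (0 : ℤ) < ⌈g x⌉ + ⌈F x⌉ := by
      have h1 := hlt x (hcastI x hx)
      have h2 : ((0 : ℤ) : ℝ) < ((⌈g x⌉ + ⌈F x⌉ : ℤ) : ℝ) := by
        push_cast
        linarith [Int.le_ceil (g x), Int.le_ceil (F x)]
      exact Int.cast_lt.1 h2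
    have : ((Finset.Ioo (-⌈F x⌉) ⌈g x⌉).card : ℤ) = ⌈g x⌉ + ⌈F x⌉ - 1 := by
      rw [Int.card_Ioo]; omega
    exact_mod_cast this
  have hend : ∀ x n k : ℤ, (x : ℝ) ∈ Set.Icc (a : ℝ) b → g x = n → F x = k →
      ((Finset.Icc (-⌊F x⌋) ⌊g x⌋).card : ℝ) = n + k + 1 := fun x n k hx hg hF => by
    have h0 : (0 : ℤ) ≤ n + k := by
      have := hle x hx
      rw [hg, hF] at this
      exact_mod_cast this
    have : ((Finset.Icc (-⌊F x⌋) ⌊g x⌋).card : ℤ) = n + k + 1 := by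
      rw [hg, hF, Int.floor_intCast, Int.floor_intCast, Int.card_Icc]; omega
    exact_mod_cast this
  have hab' : (a : ℝ) ≤ b := by exact_mod_cast hab.le
  push_cast
  rw [← Finset.Ico_insert_right hab.le, Finset.sum_insert (by simp),
    ← Finset.Ioo_insert_left hab, Finset.sum_insert (by simp), Finset.sum_insert (by simp),
    Finset.sum_insert (by simp), hend a na ka ⟨le_rfl, hab'⟩ hga hFa,
    hend b nb kb ⟨hab', le_rfl⟩ hgb hFb, Finset.sum_congr rfl hcolN, Finset.sum_congr rfl hcolI,
    hga, hFa]
  simp only [Int.floor_intCast, Int.ceil_intCast, Finset.sum_add_distrib, Finset.sum_sub_distrib]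
  ring

theorem volume_toReal_of_interior_eq_regionBetween {P : Set (ℝ × ℝ)} {f g : ℝ → ℝ} {a b : ℝ}
    (hab : a ≤ b) (hP : Convex ℝ P) (hPi : interior P = regionBetween f g (Set.Ioo a b))
    (hf : IntervalIntegrable f volume a b) (hg : IntervalIntegrable g volume a b)
    (hle : ∀ x ∈ Set.Ioo a b, f x ≤ g x) :
    (volume P).toReal = (∫ x in a..b, g x) - ∫ x in a..b, f x := by
  rw [← measure_congr (interior_ae_eq_of_null_frontier (hP.addHaar_frontier volume)), hPi,
    Measure.volume_eq_prod, volume_regionBetween_eq_integral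
      ((intervalIntegrable_iff_integrableOn_Ioo_of_le hab).1 hf)
      ((intervalIntegrable_iff_integrableOn_Ioo_of_le hab).1 hg) measurableSet_Ioo hle,
    ENNReal.toReal_ofReal (setIntegral_nonneg measurableSet_Ioo fun x hx => by
      simpa using hle x hx),
    ← integral_Ioc_eq_integral_Ioo, ← intervalIntegral.integral_of_le hab]
  exact intervalIntegral.integral_sub hg hf

theorem picks_theorem (V : Finset (ℤ × ℤ)) (P : Set (ℝ × ℝ))
    (hP : P = convexHull ℝ ((fun q : ℤ × ℤ => ((q.1 : ℝ), (q.2 : ℝ))) '' ↑V))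
    (hfull : (interior P).Nonempty)
    (A : ℝ) (hA : A = (volume P).toReal)
    (I B : ℕ)
    (hI : I = Set.ncard {p : ℤ × ℤ | ((p.1 : ℝ), (p.2 : ℝ)) ∈ interior P})
    (hB : B = Set.ncard {p : ℤ × ℤ | ((p.1 : ℝ), (p.2 : ℝ)) ∈ frontier P}) :
    A = (I : ℝ) + (B : ℝ) / 2 - 1 := by
  change P = latticeHull V at hP
  have hV : V.Nonempty := by
    rw [Finset.nonempty_iff_ne_empty]
    rintro rfl
    simp [hP, latticeHull] at hfull
  obtain ⟨p, hp, hpmin⟩ := V.exists_min_image Prod.fst hV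
  obtain ⟨q, hq, hqmax⟩ := V.exists_max_image Prod.fst hV
  obtain ⟨a, ha⟩ : ∃ a, p.1 = a := ⟨_, rfl⟩
  obtain ⟨b, hb⟩ : ∃ b, q.1 = b := ⟨_, rfl⟩
  have hVab : ∀ r ∈ V, r.1 ∈ Set.Icc a b := fun r hr =>
    ⟨ha ▸ hpmin r hr, hb ▸ hqmax r hr⟩
  have hVa : ∃ r ∈ V, r.1 = a := ⟨p, hp, ha⟩
  have hVb : ∃ r ∈ V, r.1 = b := ⟨q, hq, hb⟩
  have hRa := exists_mem_reflect_fst hVa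
  have hRb := exists_mem_reflect_fst hVb
  have hg := isUpperEnvelope_upperBoundary hVab hVa hVb
  have hF : IsUpperEnvelope (reflect V) a b (upperBoundary (reflect V)) := by
    refine isUpperEnvelope_upperBoundary (fun r hr => ?_) hRa hRb
    obtain ⟨s, hs, rfl⟩ := Finset.mem_image.1 hr
    exact hVab s hs
  have hmem : ∀ x y, (x, y) ∈ P ↔ x ∈ Set.Icc (a : ℝ) b ∧
      -upperBoundary (reflect V) x ≤ y ∧ y ≤ upperBoundary V x := fun x y => by
    rw [hP]; exact mem_latticeHull_iff hVab hVa hVb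
  have hPi := interior_eq_regionBetween (f := fun x => -upperBoundary (reflect V) x) hmem
    hF.concaveOn.neg hg.concaveOn
  obtain ⟨⟨x₀, y₀⟩, h₀⟩ := hfull
  rw [hPi] at h₀
  obtain ⟨hx₀, hy₀⟩ := h₀
  have hab : a < b := by
    have := hx₀.1.trans hx₀.2
    exact_mod_cast this
  have hab' : (a : ℝ) ≤ b := by exact_mod_cast hab.le
  have hle : ∀ x ∈ Set.Icc (a : ℝ) b, 0 ≤ upperBoundary V x + upperBoundary (reflect V) x := by
    intro x hx
    have h1 := upperBoundary_mem hVa hVb hx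
    rw [← hP, hmem] at h1
    linarith [h1.2.1]
  have hlt : ∀ x ∈ Set.Ioo (a : ℝ) b, 0 < upperBoundary V x + upperBoundary (reflect V) x :=
    fun x hx => (hg.concaveOn.add hF.concaveOn).pos_of_mem_Ioo hle ⟨hx₀.1.le, hx₀.2.le⟩
      (by simp only [Set.mem_Ioo] at hy₀; simp only [Pi.add_apply]; linarith [hy₀.1, hy₀.2]) hx
  obtain ⟨na, hga⟩ := hg.exists_intCast_left hVa
  obtain ⟨nb, hgb⟩ := hg.exists_intCast_right hVb
  obtain ⟨ka, hFa⟩ := hF.exists_intCast_left hRa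
  obtain ⟨kb, hFb⟩ := hF.exists_intCast_right hRb
  obtain ⟨ig, eg⟩ := hg.intervalIntegrable_and_two_mul_integral hV le_rfl hab le_rfl hga hgb
  obtain ⟨iF, eF⟩ := hF.intervalIntegrable_and_two_mul_integral (hV.image _) le_rfl hab le_rfl
    hFa hFb
  obtain ⟨hfin, hcount⟩ := ncard_add_ncard_interior hab hmem hPi hle hlt hga hgb hFa hFb
  have harea := volume_toReal_of_interior_eq_regionBetween hab'
    (hP ▸ convex_latticeHull V) hPi iF.neg ig (fun x hx => by linarith [hlt x hx])
  rw [intervalIntegral.integral_neg, ← hA] at harea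
  have hfront : {p : ℤ × ℤ | ((p.1 : ℝ), (p.2 : ℝ)) ∈ frontier P} =
      {p : ℤ × ℤ | ((p.1 : ℝ), (p.2 : ℝ)) ∈ P} \
        {p : ℤ × ℤ | ((p.1 : ℝ), (p.2 : ℝ)) ∈ interior P} := by
    have hcl : IsClosed P := hP ▸ (isCompact_latticeHull V).isClosed
    rw [hcl.frontier_eq]
    rfl
  have hsum := Set.ncard_sdiff_add_ncard_of_subset
    (s := {p : ℤ × ℤ | ((p.1 : ℝ), (p.2 : ℝ)) ∈ interior P})
    (t := {p : ℤ × ℤ | ((p.1 : ℝ), (p.2 : ℝ)) ∈ P}) (fun p h =>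
      (interior_subset : interior P ⊆ P) h) hfin
  rw [← hfront, ← hB, ← hI] at hsum
  rw [← hI, ← hsum] at hcount
  push_cast at hcount
  linarith
end
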